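/- Let R be a CPG representation of G_k and let 1 ≤ i ≤ 19 be such that both P_{α_i} and P_{α_{i+1}} are pure. Then one of P_{α_i}, P_{α_{i+1}} has at least ⌊(k+1)/2⌋ bends and the other has at least ⌈(k+1)/2⌉ bends; moreover, all these bend points belong to the paths P_{u^i_1}, …, P_{u^i_{k+2}}. -/

import Mathlib

/-! ## Grid paths and CPG representations -/

/-- Two grid points of `ℤ × ℤ` at L¹-distance 1 (i.e. joined by a unit grid segment). -/
def GridStep (p q : ℤ × ℤ) : Prop :=
  (p.1 - q.1).natAbs + (p.2 - q.2).natAbs = 1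

/-- A grid path: a sequence of at least two grid points, consecutive points at distance 1,
with no repeated grid point (so the traced curve neither crosses nor retraces itself). -/
structure GridPath where
  pts : List (ℤ × ℤ)
  two_le_length : 2 ≤ pts.length
  step : pts.Chain' GridStep
  nodup : pts.Nodup

namespace GridPath

theorem ne_nil (P : GridPath) : P.pts ≠ [] := by
  intro h
  have h2 := P.two_le_length
  rw [h] at h2
  simp at h2

/-- The set of grid points of a grid path. -/
def toSet (P : GridPath) : Set (ℤ × ℤ) := {p | p ∈ P.pts}

/-- The first extreme point of a grid path. -/
def first (P : GridPath) : ℤ × ℤ := P.pts.head P.ne_nil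

/-- The second extreme point of a grid path. -/
def last (P : GridPath) : ℤ × ℤ := P.pts.getLast P.ne_nil

/-- `p` is an endpoint (extreme point) of the grid path `P`. -/
def IsEndpoint (P : GridPath) (p : ℤ × ℤ) : Prop := p = P.first ∨ p = P.last

/-- `p` is an interior grid point of `P`: it lies on `P` but is not an endpoint. -/
def IsInterior (P : GridPath) (p : ℤ × ℤ) : Prop := p ∈ P.toSet ∧ ¬ P.IsEndpoint p

/-- `p` is a bend of `P`: an interior grid point at which `P` turns 90 degrees. -/
def IsBend (P : GridPath) (p : ℤ × ℤ) : Prop :=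
  ∃ a c : ℤ × ℤ, [a, p, c] <:+: P.pts ∧ a.1 ≠ c.1 ∧ a.2 ≠ c.2

/-- The set of bend points of `P`. -/
def bendSet (P : GridPath) : Set (ℤ × ℤ) := {p | P.IsBend p}

/-- `P` has at most `k` bends. -/
def BendsAtMost (P : GridPath) (k : ℕ) : Prop := P.bendSet.ncard ≤ k

end GridPath

/-- `p` and `q` are consecutive grid points of the list `l` (in either order);
equivalently, the path traced by `l` uses the unit grid segment joining `p` and `q`. -/
def ConsecIn (l : List (ℤ × ℤ)) (p q : ℤ × ℤ) : Prop :=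
  [p, q] <:+: l ∨ [q, p] <:+: l

/-- A CPG representation of a simple graph `G`: a family of pairwise interiorly disjoint
grid paths, one for each vertex, such that two distinct vertices are adjacent iff the
corresponding paths have a common point. -/
structure CPGRep {V : Type*} (G : SimpleGraph V) where
  path : V → GridPath
  interiorly_disjoint : ∀ u v : V, u ≠ v → ∀ p : ℤ × ℤ,
    p ∈ (path u).toSet → p ∈ (path v).toSet →
    (path u).IsEndpoint p ∨ (path v).IsEndpoint p
  no_shared_segment : ∀ u v : V, u ≠ v → ∀ p q : ℤ × ℤ,
    ConsecIn (path u).pts p q → ¬ ConsecIn (path v).pts p q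
  adj_iff : ∀ u v : V, u ≠ v →
    (G.Adj u v ↔ ∃ p : ℤ × ℤ, p ∈ (path u).toSet ∧ p ∈ (path v).toSet)

namespace CPGRep

variable {V : Type*} {G : SimpleGraph V}

/-- A `k`-bend CPG representation: every path has at most `k` bends. -/
def BendsAtMost (R : CPGRep G) (k : ℕ) : Prop :=
  ∀ u : V, (R.path u).BendsAtMost k

/-- `p` is a free endpoint of the path of `u`: an endpoint of `R.path u`
belonging to no other path of the representation. -/
def FreeEndpoint (R : CPGRep G) (u : V) (p : ℤ × ℤ) : Prop :=
  (R.path u).IsEndpoint p ∧ ∀ v : V, v ≠ u → p ∉ (R.path v).toSet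

end CPGRep

/-- A graph is CPG if it admits a CPG representation. -/
def IsCPG {V : Type*} (G : SimpleGraph V) : Prop := Nonempty (CPGRep G)

/-- A graph is `B_k`-CPG if it admits a CPG representation in which every path
has at most `k` bends. -/
def IsBkCPG {V : Type*} (G : SimpleGraph V) (k : ℕ) : Prop :=
  ∃ R : CPGRep G, R.BendsAtMost k

/-! ## The graph `G_k` -/

/-- Vertices of the graph `G_k`: the two special vertices `a`, `b`, the twenty secondary
vertices `α 0, …, α 19` (representing `α_1, …, α_20`), and the sewing vertices
`u i j` for `i : Fin 19`, `j : Fin (k+2)` (representing `u^{i+1}_{j+1}`). -/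
inductive GkV (k : ℕ) where
  | a : GkV k
  | b : GkV k
  | α : Fin 20 → GkV k
  | u : Fin 19 → Fin (k + 2) → GkV k

/-- The defining relation of `G_k`: `ab`; `aα_i`, `bα_i`; `α_i u^i_j`, `α_{i+1} u^i_j`;
and `u^i_j u^i_{j+1}`. -/
inductive GkRel (k : ℕ) : GkV k → GkV k → Prop
  | ab : GkRel k (GkV.a) (GkV.b)
  | aα (i : Fin 20) : GkRel k (GkV.a) (GkV.α i)
  | bα (i : Fin 20) : GkRel k (GkV.b) (GkV.α i)
  | αu (i : Fin 19) (j : Fin (k + 2)) : GkRel k (GkV.α i.castSucc) (GkV.u i j)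
  | α'u (i : Fin 19) (j : Fin (k + 2)) : GkRel k (GkV.α i.succ) (GkV.u i j)
  | uu (i : Fin 19) (j j' : Fin (k + 2)) (h : (j : ℕ) + 1 = (j' : ℕ)) :
      GkRel k (GkV.u i j) (GkV.u i j')

/-- The graph `G_k`. -/
def Gk (k : ℕ) : SimpleGraph (GkV k) := SimpleGraph.fromRel (GkRel k)

/-- A secondary path `P_{α_i}` (more generally, the path of a vertex `w`) is pure if no
endpoint of `P_a` or of `P_b` belongs to it. -/
def IsPure {k : ℕ} (R : CPGRep (Gk k)) (w : GkV k) : Prop :=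
  ∀ p : ℤ × ℤ,
    ((R.path GkV.a).IsEndpoint p ∨ (R.path GkV.b).IsEndpoint p) →
    p ∉ (R.path w).toSet

/-! ## Parity of crossings of grid walks -/

namespace GkProof

/-- Sum over consecutive pairs of a list. -/
def pairSum (φ : ℤ × ℤ → ℤ × ℤ → ZMod 2) : List (ℤ × ℤ) → ZMod 2
  | [] => 0
  | [_] => 0
  | p :: q :: l => φ p q + pairSum φ (q :: l)

/-- Crossing indicator of the vertical ray going up from the face with lower left corner `(x,y)`. -/
def cross (x y : ℤ) (p q : ℤ × ℤ) : ZMod 2 :=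
  if p.2 = q.2 ∧ y < p.2 ∧ ((p.1 = x ∧ q.1 = x + 1) ∨ (q.1 = x ∧ p.1 = x + 1)) then 1 else 0

/-- Indicator of the vertical edge going up from `(x,y)`. -/
def vert (x y : ℤ) (p q : ℤ × ℤ) : ZMod 2 :=
  if (p = (x, y) ∧ q = (x, y + 1)) ∨ (q = (x, y) ∧ p = (x, y + 1)) then 1 else 0

/-- Indicator of the horizontal edge going right from `(x,y)`. -/
def horiz (x y : ℤ) (p q : ℤ × ℤ) : ZMod 2 :=
  if (p = (x, y) ∧ q = (x + 1, y)) ∨ (q = (x, y) ∧ p = (x + 1, y)) then 1 else 0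

/-- Indicator of the open vertical ray above `(x,y)`. -/
def ray (x y : ℤ) (p : ℤ × ℤ) : ZMod 2 := if p.1 = x ∧ y < p.2 then 1 else 0

theorem gridStep_cases {p q : ℤ × ℤ} (h : GridStep p q) :
    q = (p.1 + 1, p.2) ∨ q = (p.1 - 1, p.2) ∨ q = (p.1, p.2 + 1) ∨ q = (p.1, p.2 - 1) := by
  obtain ⟨a, b⟩ := p
  obtain ⟨c, d⟩ := q
  simp only [GridStep, Prod.mk.injEq] at *
  omega

theorem gridStep_symm {p q : ℤ × ℤ} (h : GridStep p q) : GridStep q p := by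
  simp only [GridStep] at *
  omega

theorem zmod2_add_self (a : ZMod 2) : a + a = 0 := CharTwo.add_self_eq_zero a

theorem local_vert {x y : ℤ} {p q : ℤ × ℤ} (h : GridStep p q) :
    cross x y p q + cross (x - 1) y p q + vert x y p q = ray x y p + ray x y q := by
  obtain ⟨a, b⟩ := p
  rcases gridStep_cases h with rfl | rfl | rfl | rfl <;>
    simp only [cross, vert, ray, Prod.mk.injEq] <;> split_ifs <;>
    first | decide | (exfalso; omega) | (exfalso; grind)

theorem local_horiz {x y : ℤ} {p q : ℤ × ℤ} (h : GridStep p q) :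
    cross x (y - 1) p q + cross x y p q + horiz x y p q = 0 := by
  obtain ⟨a, b⟩ := p
  rcases gridStep_cases h with rfl | rfl | rfl | rfl <;>
    simp only [cross, horiz, Prod.mk.injEq] <;> split_ifs <;>
    first | decide | (exfalso; omega) | (exfalso; grind)

theorem pairSum_add3 (φ ψ χ : ℤ × ℤ → ℤ × ℤ → ZMod 2) : ∀ l : List (ℤ × ℤ),
    pairSum φ l + pairSum ψ l + pairSum χ l = pairSum (fun p q => φ p q + ψ p q + χ p q) l
  | [] => by simp [pairSum]
  | [_] => by simp [pairSum]
  | p :: q :: l => by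
    have := pairSum_add3 φ ψ χ (q :: l)
    simp only [pairSum, ← this]
    ring

theorem pairSum_tele (φ : ℤ × ℤ → ℤ × ℤ → ZMod 2) (g : ℤ × ℤ → ZMod 2)
    (h : ∀ p q, GridStep p q → φ p q = g p + g q) :
    ∀ (l : List (ℤ × ℤ)) (hl : l ≠ []), l.IsChain GridStep →
      pairSum φ l = g (l.head hl) + g (l.getLast hl)
  | [], hl, _ => absurd rfl hl
  | [p], _, _ => by simp [pairSum, zmod2_add_self]
  | p :: q :: l, _, hc => by
    rw [List.isChain_cons_cons] at hc
    have := pairSum_tele φ g h (q :: l) (by simp) hc.2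
    simp only [pairSum, this, h p q hc.1, List.head_cons]
    rw [List.getLast_cons (by simp : q :: l ≠ [])]
    have := zmod2_add_self (g q)
    linear_combination this

theorem pairSum_zero (φ : ℤ × ℤ → ℤ × ℤ → ZMod 2) (v : ℤ × ℤ)
    (h : ∀ p q, p ≠ v → q ≠ v → φ p q = 0) :
    ∀ l : List (ℤ × ℤ), v ∉ l → pairSum φ l = 0
  | [], _ => rfl
  | [_], _ => rfl
  | p :: q :: l, hv => by
    simp only [List.mem_cons, not_or] at hv
    simp only [pairSum]
    rw [h p q (Ne.symm hv.1) (Ne.symm hv.2.1),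
      pairSum_zero φ v h (q :: l) (by simp only [List.mem_cons, not_or]; exact hv.2), add_zero]

theorem vert_zero (v : ℤ × ℤ) (p q : ℤ × ℤ) (hp : p ≠ v) (hq : q ≠ v) :
    vert v.1 v.2 p q = 0 := by
  simp [vert, hp, hq]

theorem horiz_zero (v : ℤ × ℤ) (p q : ℤ × ℤ) (hp : p ≠ v) (hq : q ≠ v) :
    horiz v.1 v.2 p q = 0 := by
  simp [horiz, hp, hq]

theorem pairSum_vert (l : List (ℤ × ℤ)) (hl : l ≠ []) (hc : l.IsChain GridStep) (x y : ℤ) :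
    pairSum (cross x y) l + pairSum (cross (x - 1) y) l + pairSum (vert x y) l
      = ray x y (l.head hl) + ray x y (l.getLast hl) := by
  rw [pairSum_add3]
  exact pairSum_tele _ (ray x y) (fun p q h => local_vert h) l hl hc

theorem pairSum_horiz (l : List (ℤ × ℤ)) (hl : l ≠ []) (hc : l.IsChain GridStep) (x y : ℤ) :
    pairSum (cross x (y - 1)) l + pairSum (cross x y) l + pairSum (horiz x y) l = 0 := by
  rw [pairSum_add3]
  have := pairSum_tele _ (fun _ => 0) (fun p q h => by simpa using local_horiz (x := x) (y := y) h)
    l hl hc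
  simpa using this

theorem exists_walk : ∀ (l : List (ℤ × ℤ)), l.IsChain GridStep → ∀ a ∈ l, ∀ b ∈ l,
    ∃ (L : List (ℤ × ℤ)) (hL : L ≠ []), L.IsChain GridStep ∧ L.head hL = a ∧ L.getLast hL = b ∧
      ∀ z ∈ L, z ∈ l := by
  intro l
  induction l with
  | nil => intro _ a ha; simp at ha
  | cons x l ih =>
    intro hc
    have main : ∀ b ∈ l, ∃ (L : List (ℤ × ℤ)) (hL : L ≠ []), L.IsChain GridStep ∧
        L.head hL = x ∧ L.getLast hL = b ∧ ∀ z ∈ L, z ∈ x :: l := by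
      intro b hb
      cases l with
      | nil => simp at hb
      | cons y l =>
        rw [List.isChain_cons_cons] at hc
        obtain ⟨L, hL, h1, h2, h3, h4⟩ := ih hc.2 y (by simp) b hb
        refine ⟨x :: L, by simp, ?_, by simp, ?_, ?_⟩
        · cases L with
          | nil => exact absurd rfl hL
          | cons w L =>
            simp only [List.head_cons] at h2
            subst h2
            rw [List.isChain_cons_cons]
            exact ⟨hc.1, h1⟩
        · rw [List.getLast_cons hL]; exact h3
        · intro z hz
          rcases List.mem_cons.1 hz with rfl | hz
          · simp
          · exact List.mem_cons_of_mem _ (h4 z hz)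
    intro a ha b hb
    rcases List.mem_cons.1 ha with rfl | ha'
    · rcases List.mem_cons.1 hb with rfl | hb
      · exact ⟨[b], by simp, by simp, by simp, by simp, by simp⟩
      · exact main b hb
    · rcases List.mem_cons.1 hb with rfl | hb
      · obtain ⟨L, hL, h1, h2, h3, h4⟩ := main a ha'
        refine ⟨L.reverse, by simpa using hL, ?_, ?_, ?_, ?_⟩
        · rw [List.isChain_reverse]
          exact h1.imp (fun _ _ h => gridStep_symm h)
        · rw [List.head_reverse]; exact h3
        · rw [List.getLast_reverse]; exact h2
        · intro z hz; exact h4 z (List.mem_reverse.1 hz)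
      · obtain ⟨L, hL, h1, h2, h3, h4⟩ := ih hc.tail a ha' b hb
        exact ⟨L, hL, h1, h2, h3, fun z hz => List.mem_cons_of_mem _ (h4 z hz)⟩

theorem const_on_chain (f : ℤ × ℤ → ZMod 2) (off : ℤ × ℤ → Prop)
    (hf : ∀ v w, GridStep v w → off v → off w → f v = f w) :
    ∀ l : List (ℤ × ℤ), l.IsChain GridStep → (∀ z ∈ l, off z) →
      ∀ a ∈ l, ∀ b ∈ l, f a = f b := by
  intro l
  induction l with
  | nil => intro _ _ a ha; simp at ha
  | cons x l ih =>
    intro hc ho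
    have main : ∀ b ∈ x :: l, f x = f b := by
      intro b hb
      rcases List.mem_cons.1 hb with rfl | hb
      · rfl
      · cases l with
        | nil => simp at hb
        | cons y l =>
          rw [List.isChain_cons_cons] at hc
          rw [hf x y hc.1 (ho x (by simp)) (ho y (by simp))]
          exact ih hc.2 (fun z hz => ho z (List.mem_cons_of_mem _ hz)) y (by simp) b hb
    intro a ha b hb
    rw [← main a ha, main b hb]

/-- The parity form of the Jordan curve theorem that we need. -/
theorem jordan (p r₁ r₂ m n : ℤ × ℤ) (t₁ t₂ L₃ : List (ℤ × ℤ)) (h₃ : L₃ ≠ [])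
    (c₁ : (p :: r₁ :: t₁).IsChain GridStep) (c₂ : (p :: r₂ :: t₂).IsChain GridStep)
    (c₃ : L₃.IsChain GridStep)
    (n₁ : p ∉ r₁ :: t₁) (n₂ : p ∉ r₂ :: t₂) (n₃ : p ∉ L₃)
    (e₁ : (r₁ :: t₁).getLast (by simp) = L₃.head h₃)
    (e₂ : (r₂ :: t₂).getLast (by simp) = L₃.getLast h₃)
    (hm : GridStep p m) (hn : GridStep p n)
    (hmn : m ≠ n) (hr : r₁ ≠ r₂) (h1m : r₁ ≠ m) (h1n : r₁ ≠ n) (h2m : r₂ ≠ m) (h2n : r₂ ≠ n)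
    (straight : m.1 = n.1 ∨ m.2 = n.2)
    (off : ℤ × ℤ → Prop)
    (hoff : ∀ z, off z → z ∉ p :: r₁ :: t₁ ∧ z ∉ p :: r₂ :: t₂ ∧ z ∉ L₃)
    (om : off m) (on : off n)
    (conn : ∀ f : ℤ × ℤ → ZMod 2, (∀ v w, GridStep v w → off v → off w → f v = f w) →
      f m = f n) : False := by
  set F : ℤ → ℤ → ZMod 2 := fun x y => pairSum (cross x y) (p :: r₁ :: t₁) +
    pairSum (cross x y) (p :: r₂ :: t₂) + pairSum (cross x y) L₃ with hF
  set V : ℤ → ℤ → ZMod 2 := fun x y => pairSum (vert x y) (p :: r₁ :: t₁) +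
    pairSum (vert x y) (p :: r₂ :: t₂) + pairSum (vert x y) L₃ with hV
  set H : ℤ → ℤ → ZMod 2 := fun x y => pairSum (horiz x y) (p :: r₁ :: t₁) +
    pairSum (horiz x y) (p :: r₂ :: t₂) + pairSum (horiz x y) L₃ with hH
  have FV : ∀ x y, F x y + F (x - 1) y + V x y = 0 := by
    intro x y
    have a1 := pairSum_vert (p :: r₁ :: t₁) (by simp) c₁ x y
    have a2 := pairSum_vert (p :: r₂ :: t₂) (by simp) c₂ x y
    have a3 := pairSum_vert L₃ h₃ c₃ x y
    rw [List.getLast_cons (by simp : r₁ :: t₁ ≠ []), e₁, List.head_cons] at a1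
    rw [List.getLast_cons (by simp : r₂ :: t₂ ≠ []), e₂, List.head_cons] at a2
    have b1 := zmod2_add_self (ray x y p)
    have b2 := zmod2_add_self (ray x y (L₃.head h₃))
    have b3 := zmod2_add_self (ray x y (L₃.getLast h₃))
    simp only [hF, hV]
    linear_combination a1 + a2 + a3 + b1 + b2 + b3
  have FH : ∀ x y, F x (y - 1) + F x y + H x y = 0 := by
    intro x y
    have a1 := pairSum_horiz (p :: r₁ :: t₁) (by simp) c₁ x y
    have a2 := pairSum_horiz (p :: r₂ :: t₂) (by simp) c₂ x y
    have a3 := pairSum_horiz L₃ h₃ c₃ x y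
    simp only [hF, hH]
    linear_combination a1 + a2 + a3
  have V0 : ∀ z, off z → V z.1 z.2 = 0 := by
    intro z hz
    obtain ⟨z1, z2, z3⟩ := hoff z hz
    simp only [hV]
    rw [pairSum_zero _ z (vert_zero z) _ z1, pairSum_zero _ z (vert_zero z) _ z2,
      pairSum_zero _ z (vert_zero z) _ z3]
    simp
  have H0 : ∀ z, off z → H z.1 z.2 = 0 := by
    intro z hz
    obtain ⟨z1, z2, z3⟩ := hoff z hz
    simp only [hH]
    rw [pairSum_zero _ z (horiz_zero z) _ z1, pairSum_zero _ z (horiz_zero z) _ z2,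
      pairSum_zero _ z (horiz_zero z) _ z3]
    simp
  have Vp : V p.1 p.2 = vert p.1 p.2 p r₁ + vert p.1 p.2 p r₂ := by
    simp only [hV, pairSum]
    rw [pairSum_zero _ p (vert_zero p) _ n₁, pairSum_zero _ p (vert_zero p) _ n₂,
      pairSum_zero _ p (vert_zero p) _ n₃]
    simp
  have Hp : H p.1 p.2 = horiz p.1 p.2 p r₁ + horiz p.1 p.2 p r₂ := by
    simp only [hH, pairSum]
    rw [pairSum_zero _ p (horiz_zero p) _ n₁, pairSum_zero _ p (horiz_zero p) _ n₂,
      pairSum_zero _ p (horiz_zero p) _ n₃]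
    simp
  have eqz : ∀ a b c : ZMod 2, a + b + c = 0 → c = 0 → a = b := by decide
  have stepR : ∀ z, off z → F z.1 z.2 = F (z.1 - 1) z.2 := fun z hz => eqz _ _ _ (FV _ _) (V0 z hz)
  have stepU : ∀ z, off z → F z.1 (z.2 - 1) = F z.1 z.2 := fun z hz => eqz _ _ _ (FH _ _) (H0 z hz)
  have key := conn (fun z => F z.1 z.2) (by
    intro v w hvw ov ow
    have hv1 := stepR v ov
    have hv2 := stepU v ov
    have hw1 := stepR w ow
    have hw2 := stepU w ow
    obtain ⟨a, b⟩ := v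
    rcases gridStep_cases hvw with rfl | rfl | rfl | rfl
    · simpa using hw1.symm
    · simpa using hv1
    · simpa using hw2
    · simpa using hv2.symm)
  have mR := stepR m om
  have mU := stepU m om
  have nR := stepR n on
  have nU := stepU n on
  have FVp := FV p.1 p.2
  have FHp := FH p.1 p.2
  rw [Vp] at FVp
  rw [Hp] at FHp
  have s1 := gridStep_cases (List.isChain_cons_cons.1 c₁).1
  have s2 := gridStep_cases (List.isChain_cons_cons.1 c₂).1
  have hm' := gridStep_cases hm
  have hn' := gridStep_cases hn
  clear_value F V H
  clear hm hn c₁ c₂ c₃ n₁ n₂ n₃ e₁ e₂ conn hoff om on V0 H0 FV FH Vp Hp hF hV hH stepR stepU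
  obtain ⟨a, b⟩ := p
  simp only at *
  have fin : ∀ u v : ZMod 2, u = v → u + v + 1 = 0 → False := by decide
  have fin' : ∀ u v : ZMod 2, u = v → v + u + 1 = 0 → False := by decide
  rcases hm' with rfl | rfl | rfl | rfl <;> rcases hn' with rfl | rfl | rfl | rfl <;>
    first
    | exact absurd rfl hmn
    | (exfalso; simp at straight; done)
    | (rcases s1 with rfl | rfl | rfl | rfl <;> rcases s2 with rfl | rfl | rfl | rfl <;>
        first
        | exact absurd rfl hr
        | exact absurd rfl h1m
        | exact absurd rfl h1n
        | exact absurd rfl h2m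
        | exact absurd rfl h2n
        | (simp [vert, horiz] at *; grind))

/-! ## Local structure of grid paths -/

theorem interior_split {P : GridPath} {p : ℤ × ℤ} (hp : p ∈ P.toSet) (he : ¬ P.IsEndpoint p) :
    ∃ pre m n post, P.pts = pre ++ m :: p :: n :: post := by
  obtain ⟨s, t, hst⟩ := List.append_of_mem (show p ∈ P.pts from hp)
  rcases List.eq_nil_or_concat s with rfl | ⟨s', m, rfl⟩
  · exfalso
    apply he
    left
    simp [GridPath.first, hst]
  · cases t with
    | nil =>
      exfalso
      apply he
      right
      simp [GridPath.last, hst]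
    | cons n t => exact ⟨s', m, n, t, by simp [hst]⟩

theorem first_mem (P : GridPath) : P.first ∈ P.toSet := List.head_mem P.ne_nil

theorem last_mem (P : GridPath) : P.last ∈ P.toSet := List.getLast_mem P.ne_nil

theorem endpoint_mem {P : GridPath} {p : ℤ × ℤ} (h : P.IsEndpoint p) : p ∈ P.toSet := by
  rcases h with rfl | rfl
  · exact first_mem P
  · exact last_mem P

/-- Reading a path from one of its endpoints. -/
theorem endpoint_split {P : GridPath} {p : ℤ × ℤ} (h : P.IsEndpoint p) :
    ∃ r t, (p :: r :: t).IsChain GridStep ∧ p ∉ r :: t ∧ ConsecIn P.pts p r ∧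
      (∀ z, z ∈ p :: r :: t ↔ z ∈ P.toSet) ∧
      ∀ q, P.IsEndpoint q → q ≠ p → (r :: t).getLast (by simp) = q := by
  have h2 := P.two_le_length
  have hc : P.pts.IsChain GridStep := P.step
  have hn := P.nodup
  rcases h with h | h
  · match hP : P.pts, h2 with
    | x :: r :: t, _ =>
      have hx : p = x := by simp [h, GridPath.first, hP]
      subst hx
      rw [hP] at hc hn
      refine ⟨r, t, hc, (List.nodup_cons.1 hn).1, Or.inl ⟨[], t, by simp⟩, ?_, ?_⟩
      · intro z; simp [GridPath.toSet, hP]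
      · intro q hq hqp
        rcases hq with hq | hq
        · exact absurd (hq.trans h.symm) hqp
        · rw [hq]; simp [GridPath.last, hP]
  · have h2' : 2 ≤ P.pts.reverse.length := by simpa using h2
    match hP : P.pts.reverse, h2' with
    | x :: r :: t, _ =>
      have hP' : P.pts = (x :: r :: t).reverse := by rw [← hP, List.reverse_reverse]
      have hx : p = x := by simp [h, GridPath.last, hP']
      subst hx
      have hc' : (p :: r :: t).IsChain GridStep := by
        rw [← hP, List.isChain_reverse]
        exact hc.imp (fun _ _ h => gridStep_symm h)
      have hn' : (p :: r :: t).Nodup := by rw [← hP, List.nodup_reverse]; exact hn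
      refine ⟨r, t, hc', (List.nodup_cons.1 hn').1, Or.inr ⟨t.reverse, [], by simp [hP']⟩, ?_, ?_⟩
      · intro z
        rw [← hP, List.mem_reverse]; rfl
      · intro q hq hqp
        rcases hq with hq | hq
        · rw [hq]; simp only [GridPath.first, hP', List.head_reverse]
          rw [List.getLast_cons (by simp : r :: t ≠ [])]
        · exact absurd (hq.trans h.symm) hqp

theorem five_neighbours {p a b c d e : ℤ × ℤ} (ha : GridStep p a) (hb : GridStep p b)
    (hc : GridStep p c) (hd : GridStep p d) (he : GridStep p e)
    (hn : [a, b, c, d, e].Nodup) : False := by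
  have hsub : [a, b, c, d, e].toFinset ⊆
      ({(p.1 + 1, p.2), (p.1 - 1, p.2), (p.1, p.2 + 1), (p.1, p.2 - 1)} : Finset (ℤ × ℤ)) := by
    intro z hz
    have : GridStep p z := by
      simp only [List.mem_toFinset, List.mem_cons, List.not_mem_nil, or_false] at hz
      rcases hz with rfl | rfl | rfl | rfl | rfl <;> assumption
    simpa using gridStep_cases this
  have h1 := Finset.card_le_card hsub
  rw [List.toFinset_card_of_nodup hn] at h1
  have h2 := h1.trans Finset.card_le_four
  simp at h2

/-! ## The graph `G_k` and its representation -/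

variable {k : ℕ}

/-- The two secondary vertices under consideration. -/
def W (k : ℕ) (i : Fin 19) (s : Bool) : GkV k := if s then GkV.α i.succ else GkV.α i.castSucc

theorem meet {R : CPGRep (Gk k)} {v w : GkV k} (hne : v ≠ w) (h : GkRel k v w) :
    ∃ p, p ∈ (R.path v).toSet ∧ p ∈ (R.path w).toSet := by
  apply (R.adj_iff v w hne).1
  simp only [Gk, SimpleGraph.fromRel_adj]
  exact ⟨hne, Or.inl h⟩

theorem apart {R : CPGRep (Gk k)} {v w : GkV k} (hne : v ≠ w) (h : ¬ GkRel k v w)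
    (h' : ¬ GkRel k w v) {p : ℤ × ℤ} (hv : p ∈ (R.path v).toSet) (hw : p ∈ (R.path w).toSet) :
    False := by
  have := (R.adj_iff v w hne).2 ⟨p, hv, hw⟩
  simp only [Gk, SimpleGraph.fromRel_adj] at this
  rcases this.2 with h1 | h1
  · exact h h1
  · exact h' h1

section

variable (R : CPGRep (Gk k)) (i : Fin 19)

theorem apart_au {j : Fin (k + 2)} {p : ℤ × ℤ} (h : p ∈ (R.path GkV.a).toSet)
    (h' : p ∈ (R.path (GkV.u i j)).toSet) : False :=
  apart (by simp) (by rintro ⟨⟩) (by rintro ⟨⟩) h h'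

theorem apart_bu {j : Fin (k + 2)} {p : ℤ × ℤ} (h : p ∈ (R.path GkV.b).toSet)
    (h' : p ∈ (R.path (GkV.u i j)).toSet) : False :=
  apart (by simp) (by rintro ⟨⟩) (by rintro ⟨⟩) h h'

theorem no_αα {x y : Fin 20} : ¬ GkRel k (GkV.α x) (GkV.α y) := by
  intro h
  generalize hv : (GkV.α x : GkV k) = v at h
  generalize hw : (GkV.α y : GkV k) = w at h
  cases h <;> simp at hv hw

theorem apart_WW {s : Bool} {p : ℤ × ℤ} (h : p ∈ (R.path (W k i s)).toSet)
    (h' : p ∈ (R.path (W k i !s)).toSet) : False := by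
  have hne : i.castSucc ≠ i.succ := (Fin.castSucc_lt_succ).ne
  cases s
  · exact apart (by simpa [W] using hne) no_αα no_αα h h'
  · exact apart (by simpa [W] using hne.symm) no_αα no_αα h h'

theorem W_ne_a (s : Bool) : GkV.a ≠ W k i s := by cases s <;> simp [W]
theorem W_ne_b (s : Bool) : GkV.b ≠ W k i s := by cases s <;> simp [W]
theorem W_ne_u (s : Bool) (j) : W k i s ≠ GkV.u i j := by cases s <;> simp [W]

theorem meet_Wu (s : Bool) (j) : ∃ p, p ∈ (R.path (W k i s)).toSet ∧
    p ∈ (R.path (GkV.u i j)).toSet := by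
  apply meet (W_ne_u i s j)
  rcases s with _ | _
  on_goal 2 => exact GkRel.α'u i j
  exact GkRel.αu i j

/-- Ends of pure paths: one is on `P_a`, the other on `P_b`. -/
theorem pure_ends {s : Bool} (hp : IsPure R (W k i s)) :
    ((R.path (W k i s)).first ∈ (R.path GkV.a).toSet ∧
      (R.path (W k i s)).last ∈ (R.path GkV.b).toSet) ∨
    ((R.path (W k i s)).first ∈ (R.path GkV.b).toSet ∧
      (R.path (W k i s)).last ∈ (R.path GkV.a).toSet) := by
  obtain ⟨x, xa, xw⟩ : ∃ p, p ∈ (R.path GkV.a).toSet ∧ p ∈ (R.path (W k i s)).toSet := by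
    apply meet (W_ne_a i s)
    cases s <;> exact GkRel.aα _
  obtain ⟨y, yb, yw⟩ : ∃ p, p ∈ (R.path GkV.b).toSet ∧ p ∈ (R.path (W k i s)).toSet := by
    apply meet (W_ne_b i s)
    cases s <;> exact GkRel.bα _
  have hx : (R.path (W k i s)).IsEndpoint x := by
    rcases R.interiorly_disjoint _ _ (W_ne_a i s) x xa xw with h | h
    · exact absurd xw (hp x (Or.inl h))
    · exact h
  have hy : (R.path (W k i s)).IsEndpoint y := by
    rcases R.interiorly_disjoint _ _ (W_ne_b i s) y yb yw with h | h
    · exact absurd yw (hp y (Or.inr h))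
    · exact h
  have hxy : x ≠ y := by
    rintro rfl
    exact hp x (R.interiorly_disjoint _ _ (by simp) x xa yb) xw
  rcases hx with rfl | rfl <;> rcases hy with rfl | rfl
  · exact absurd rfl hxy
  · exact Or.inl ⟨xa, yb⟩
  · exact Or.inr ⟨yb, xa⟩
  · exact absurd rfl hxy

theorem not_end {s : Bool} (hp : IsPure R (W k i s)) {j : Fin (k + 2)} {p : ℤ × ℤ}
    (hu : p ∈ (R.path (GkV.u i j)).toSet) : ¬ (R.path (W k i s)).IsEndpoint p := by
  rcases pure_ends R i hp with ⟨h1, h2⟩ | ⟨h1, h2⟩ <;> rintro (rfl | rfl)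
  · exact apart_au R i h1 hu
  · exact apart_bu R i h2 hu
  · exact apart_bu R i h1 hu
  · exact apart_au R i h2 hu

theorem u_end {s : Bool} (hp : IsPure R (W k i s)) {j : Fin (k + 2)} {p : ℤ × ℤ}
    (hw : p ∈ (R.path (W k i s)).toSet)
    (hu : p ∈ (R.path (GkV.u i j)).toSet) : (R.path (GkV.u i j)).IsEndpoint p := by
  rcases R.interiorly_disjoint _ _ (W_ne_u i s j) p hw hu with h | h
  · exact absurd h (not_end R i hp hu)
  · exact h

/-- The contact point of a sewing path with a secondary path is unique. -/
theorem contact_unique (hp : ∀ s, IsPure R (W k i s)) {s : Bool} {j : Fin (k + 2)} {p q : ℤ × ℤ}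
    (hpw : p ∈ (R.path (W k i s)).toSet) (hpu : p ∈ (R.path (GkV.u i j)).toSet)
    (hqw : q ∈ (R.path (W k i s)).toSet) (hqu : q ∈ (R.path (GkV.u i j)).toSet) : p = q := by
  obtain ⟨x, xw, xu⟩ := meet_Wu R i (!s) j
  have e1 := u_end R i (hp s) hpw hpu
  have e2 := u_end R i (hp s) hqw hqu
  have e3 := u_end R i (hp !s) xw xu
  have n1 : p ≠ x := by rintro rfl; exact apart_WW R i hpw xw
  have n2 : q ≠ x := by rintro rfl; exact apart_WW R i hqw xw
  unfold GridPath.IsEndpoint at e1 e2 e3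
  grind

theorem endpoint_on_W (hp : ∀ s, IsPure R (W k i s)) {j : Fin (k + 2)} {p : ℤ × ℤ}
    (he : (R.path (GkV.u i j)).IsEndpoint p) : ∃ s, p ∈ (R.path (W k i s)).toSet := by
  obtain ⟨x, xw, xu⟩ := meet_Wu R i true j
  obtain ⟨y, yw, yu⟩ := meet_Wu R i false j
  have e1 := u_end R i (hp true) xw xu
  have e2 := u_end R i (hp false) yw yu
  have n1 : x ≠ y := by rintro rfl; exact apart_WW R i xw yw
  have : p = x ∨ p = y := by
    unfold GridPath.IsEndpoint at e1 e2 he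
    grind
  rcases this with rfl | rfl
  · exact ⟨_, xw⟩
  · exact ⟨_, yw⟩

theorem step_of_consec {P : GridPath} {p q : ℤ × ℤ} (h : ConsecIn P.pts p q) : GridStep p q := by
  have hc : P.pts.IsChain GridStep := P.step
  rcases h with h | h
  · have := hc.infix h
    simpa using this
  · have := hc.infix h
    exact gridStep_symm (by simpa using this)

theorem ne_of_consec {v w : GkV k} (hvw : v ≠ w) {p q r : ℤ × ℤ}
    (h : ConsecIn (R.path v).pts p q) (h' : ConsecIn (R.path w).pts p r) : q ≠ r := by
  rintro rfl
  exact R.no_shared_segment v w hvw p q h h'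

theorem u_ne {j j' : Fin (k + 2)} (h : j ≠ j') : (GkV.u i j : GkV k) ≠ GkV.u i j' := by
  simpa using h

theorem split_consec {P : GridPath} {pre post : List (ℤ × ℤ)} {m p n : ℤ × ℤ}
    (h : P.pts = pre ++ m :: p :: n :: post) :
    ConsecIn P.pts p m ∧ ConsecIn P.pts p n ∧ m ≠ n := by
  refine ⟨Or.inr ⟨pre, n :: post, by simp [h]⟩, Or.inl ⟨pre ++ [m], post, by simp [h]⟩, ?_⟩
  have := P.nodup
  rw [h] at this
  have := (List.nodup_append.1 this).2.1
  simp at this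
  tauto

/-- At most two sewing paths may touch a secondary path at a given point. -/
theorem not_three {s : Bool} (hp : IsPure R (W k i s)) {p : ℤ × ℤ} {j₁ j₂ j₃ : Fin (k + 2)}
    (h12 : j₁ ≠ j₂) (h13 : j₁ ≠ j₃) (h23 : j₂ ≠ j₃)
    (hw : p ∈ (R.path (W k i s)).toSet) (h1 : p ∈ (R.path (GkV.u i j₁)).toSet)
    (h2 : p ∈ (R.path (GkV.u i j₂)).toSet) (h3 : p ∈ (R.path (GkV.u i j₃)).toSet) : False := by
  obtain ⟨pre, m, n, post, hs⟩ := interior_split hw (not_end R i hp h1)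
  obtain ⟨cm, cn, hmn⟩ := split_consec hs
  obtain ⟨r₁, -, -, -, c1, -⟩ := endpoint_split (u_end R i hp hw h1)
  obtain ⟨r₂, -, -, -, c2, -⟩ := endpoint_split (u_end R i hp hw h2)
  obtain ⟨r₃, -, -, -, c3, -⟩ := endpoint_split (u_end R i hp hw h3)
  refine five_neighbours (step_of_consec cm) (step_of_consec cn) (step_of_consec c1)
    (step_of_consec c2) (step_of_consec c3) ?_
  have a1 := ne_of_consec R (W_ne_u i s j₁) cm c1
  have a2 := ne_of_consec R (W_ne_u i s j₂) cm c2
  have a3 := ne_of_consec R (W_ne_u i s j₃) cm c3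
  have b1 := ne_of_consec R (W_ne_u i s j₁) cn c1
  have b2 := ne_of_consec R (W_ne_u i s j₂) cn c2
  have b3 := ne_of_consec R (W_ne_u i s j₃) cn c3
  have d12 := ne_of_consec R (u_ne i h12) c1 c2
  have d13 := ne_of_consec R (u_ne i h13) c1 c3
  have d23 := ne_of_consec R (u_ne i h23) c2 c3
  simp
  tauto

theorem interior_list {P : GridPath} {p : ℤ × ℤ} :
    p ∈ P.pts.tail.dropLast → p ∈ P.toSet ∧ ¬ P.IsEndpoint p := by
  intro h
  have hn := P.nodup
  have hl := P.two_le_length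
  obtain ⟨x, t, hx⟩ := List.exists_cons_of_ne_nil P.ne_nil
  have ht : t ≠ [] := by rintro rfl; simp [hx] at hl
  have h' : p ∈ t.dropLast := by simpa [hx] using h
  have hd := List.dropLast_append_getLast ht
  rw [hx] at hn
  obtain ⟨hn1, hn2⟩ := List.nodup_cons.1 hn
  have hpt : p ∈ t := List.mem_of_mem_dropLast h'
  refine ⟨by simp [GridPath.toSet, hx, hpt], ?_⟩
  rintro (h1 | h1)
  · apply hn1
    have : p = x := by rw [h1]; simp [GridPath.first, hx]
    rwa [← this]
  · have : p = t.getLast ht := by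
      rw [h1]; simp only [GridPath.last, hx]; rw [List.getLast_cons ht]
    rw [← hd] at hn2
    have := (List.nodup_append.1 hn2).2.2 p h' (t.getLast ht) (by simp)
    contradiction

theorem mem_interior_list {P : GridPath} {p : ℤ × ℤ} (h : p ∈ P.toSet) (he : ¬ P.IsEndpoint p) :
    p ∈ P.pts.tail.dropLast := by
  obtain ⟨pre, m, n, post, hs⟩ := interior_split h he
  rw [hs]
  cases pre with
  | nil => simp
  | cons x pre => simp [List.dropLast_append_of_ne_nil, List.dropLast]

/-- The heart of the argument: two sewing paths meeting on a secondary path force a bend. -/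
theorem bend_at (hp : ∀ s, IsPure R (W k i s)) {s : Bool} {p : ℤ × ℤ} {j₁ j₂ : Fin (k + 2)}
    (h12 : j₁ ≠ j₂) (hw : p ∈ (R.path (W k i s)).toSet) (h1 : p ∈ (R.path (GkV.u i j₁)).toSet)
    (h2 : p ∈ (R.path (GkV.u i j₂)).toSet) : (R.path (W k i s)).IsBend p := by
  obtain ⟨pre, m, n, post, hs⟩ := interior_split hw (not_end R i (hp s) h1)
  by_contra hb
  have straight : m.1 = n.1 ∨ m.2 = n.2 := by
    by_contra hcon
    rw [not_or] at hcon
    exact hb ⟨m, n, ⟨pre, post, by simp [hs]⟩, hcon.1, hcon.2⟩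
  obtain ⟨cm, cn, hmn⟩ := split_consec hs
  obtain ⟨r₁, t₁, ch1, nm1, c1, mem1, last1⟩ := endpoint_split (u_end R i (hp s) hw h1)
  obtain ⟨r₂, t₂, ch2, nm2, c2, mem2, last2⟩ := endpoint_split (u_end R i (hp s) hw h2)
  obtain ⟨q₁, q1w, q1u⟩ := meet_Wu R i (!s) j₁
  obtain ⟨q₂, q2w, q2u⟩ := meet_Wu R i (!s) j₂
  have q1p : q₁ ≠ p := by rintro rfl; exact apart_WW R i hw q1w
  have q2p : q₂ ≠ p := by rintro rfl; exact apart_WW R i hw q2w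
  have l1 := last1 q₁ (u_end R i (hp !s) q1w q1u) q1p
  have l2 := last2 q₂ (u_end R i (hp !s) q2w q2u) q2p
  have hcQ : (R.path (W k i !s)).pts.tail.dropLast.IsChain GridStep := by
    have : (R.path (W k i !s)).pts.IsChain GridStep := (R.path (W k i !s)).step
    exact this.tail.dropLast
  obtain ⟨L, hL, hLc, hLh, hLl, hLm⟩ := exists_walk _ hcQ
    q₁ (mem_interior_list q1w (not_end R i (hp !s) q1u))
    q₂ (mem_interior_list q2w (not_end R i (hp !s) q2u))
  have hcP : (pre ++ m :: p :: n :: post).IsChain GridStep := by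
    rw [← hs]; exact (R.path (W k i s)).step
  have hnP : (pre ++ m :: p :: n :: post).Nodup := by
    rw [← hs]; exact (R.path (W k i s)).nodup
  -- points away from the closed curve
  have offW : ∀ z ∈ (R.path (W k i s)).toSet, z ≠ p →
      z ∉ p :: r₁ :: t₁ ∧ z ∉ p :: r₂ :: t₂ ∧ z ∉ L := by
    intro z hz hzp
    refine ⟨fun h => hzp ?_, fun h => hzp ?_, fun h => ?_⟩
    · exact contact_unique R i hp hz ((mem1 z).1 h) hw h1
    · exact contact_unique R i hp hz ((mem2 z).1 h) hw h2
    · exact apart_WW R i hz (interior_list (hLm z h)).1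
  have offA : ∀ z ∈ (R.path GkV.a).toSet,
      z ∉ p :: r₁ :: t₁ ∧ z ∉ p :: r₂ :: t₂ ∧ z ∉ L := by
    intro z hz
    refine ⟨fun h => apart_au R i hz ((mem1 z).1 h), fun h => apart_au R i hz ((mem2 z).1 h),
      fun h => ?_⟩
    obtain ⟨g1, g2⟩ := interior_list (hLm z h)
    rcases R.interiorly_disjoint _ _ (W_ne_a i !s) z hz g1 with h | h
    · exact hp (!s) z (Or.inl h) g1
    · exact g2 h
  have offB : ∀ z ∈ (R.path GkV.b).toSet,
      z ∉ p :: r₁ :: t₁ ∧ z ∉ p :: r₂ :: t₂ ∧ z ∉ L := by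
    intro z hz
    refine ⟨fun h => apart_bu R i hz ((mem1 z).1 h), fun h => apart_bu R i hz ((mem2 z).1 h),
      fun h => ?_⟩
    obtain ⟨g1, g2⟩ := interior_list (hLm z h)
    rcases R.interiorly_disjoint _ _ (W_ne_b i !s) z hz g1 with h | h
    · exact hp (!s) z (Or.inr h) g1
    · exact g2 h
  have hpreW : ∀ z ∈ pre ++ [m], z ∈ (R.path (W k i s)).toSet ∧ z ≠ p := by
    intro z hz
    constructor
    · show z ∈ (R.path (W k i s)).pts
      rw [hs]; simp at hz ⊢; tauto
    · rintro rfl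
      have h0 : (pre ++ [m] ++ z :: n :: post).Nodup := by simpa using hnP
      exact (List.nodup_append.1 h0).2.2 z hz z (by simp) rfl
  have hpostW : ∀ z ∈ n :: post, z ∈ (R.path (W k i s)).toSet ∧ z ≠ p := by
    intro z hz
    constructor
    · show z ∈ (R.path (W k i s)).pts
      rw [hs]; simp at hz ⊢; tauto
    · rintro rfl
      have h0 : (pre ++ [m] ++ z :: n :: post).Nodup := by simpa using hnP
      exact (List.nodup_cons.1 (List.nodup_append.1 h0).2.1).1 hz
  have cpre : (pre ++ [m]).IsChain GridStep :=
    hcP.infix ⟨[], p :: n :: post, by simp⟩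
  have cpost : (n :: post).IsChain GridStep :=
    hcP.infix ⟨pre ++ [m, p], [], by simp⟩
  have hfirst : (R.path (W k i s)).first ∈ pre ++ [m] := by
    simp only [GridPath.first, hs]
    cases pre <;> simp
  have hlast : (R.path (W k i s)).last ∈ n :: post := by
    have : (R.path (W k i s)).last = (n :: post).getLast (by simp) := by
      simp only [GridPath.last, hs]
      rw [List.getLast_append_of_ne_nil _ (by simp : m :: p :: n :: post ≠ [])]
      simp
    rw [this]
    exact List.getLast_mem _
  refine jordan p r₁ r₂ m n t₁ t₂ L hL ch1 ch2 hLc nm1 nm2 ?_ (l1.trans hLh.symm)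
    (l2.trans hLl.symm) (step_of_consec cm) (step_of_consec cn) hmn
    (ne_of_consec R (u_ne i h12) c1 c2)
    (ne_of_consec R (W_ne_u i s j₁).symm c1 cm)
    (ne_of_consec R (W_ne_u i s j₁).symm c1 cn)
    (ne_of_consec R (W_ne_u i s j₂).symm c2 cm)
    (ne_of_consec R (W_ne_u i s j₂).symm c2 cn)
    straight (fun z => z ∉ p :: r₁ :: t₁ ∧ z ∉ p :: r₂ :: t₂ ∧ z ∉ L) (fun z hz => hz) ?_ ?_ ?_
  · exact fun h => apart_WW R i hw (interior_list (hLm p h)).1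
  · have := hpreW m (by simp)
    exact offW m this.1 this.2
  · have := hpostW n (by simp)
    exact offW n this.1 this.2
  · intro f hf
    have k1 := const_on_chain f _ hf _ cpre
      (fun z hz => offW z (hpreW z hz).1 (hpreW z hz).2) m (by simp) _ hfirst
    have k2 := const_on_chain f _ hf _ cpost
      (fun z hz => offW z (hpostW z hz).1 (hpostW z hz).2) _ hlast n (by simp)
    have kA := const_on_chain f _ hf _ (R.path GkV.a).step offA
    have kB := const_on_chain f _ hf _ (R.path GkV.b).step offB
    obtain ⟨x, xa, xb⟩ := meet (R := R) (by simp) GkRel.ab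
    rw [k1, ← k2]
    rcases pure_ends R i (hp s) with ⟨g1, g2⟩ | ⟨g1, g2⟩
    · rw [kA _ g1 x xa, kB x xb _ g2]
    · rw [kB _ g1 x xb, kA x xa _ g2]

/-- Consecutive sewing paths meet on a secondary path. -/
theorem exists_contact (hp : ∀ s, IsPure R (W k i s)) {j j' : Fin (k + 2)}
    (h : (j : ℕ) + 1 = (j' : ℕ)) : ∃ (s : Bool) (p : ℤ × ℤ), p ∈ (R.path (W k i s)).toSet ∧
      p ∈ (R.path (GkV.u i j)).toSet ∧ p ∈ (R.path (GkV.u i j')).toSet := by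
  have hne : j ≠ j' := by rintro rfl; omega
  obtain ⟨p, h1, h2⟩ := meet (R := R) (u_ne i hne) (GkRel.uu i j j' h)
  rcases R.interiorly_disjoint _ _ (u_ne i hne) p h1 h2 with he | he
  · obtain ⟨s, hs⟩ := endpoint_on_W R i hp he
    exact ⟨s, p, hs, h1, h2⟩
  · obtain ⟨s, hs⟩ := endpoint_on_W R i hp he
    exact ⟨s, p, hs, h1, h2⟩

/-- The set of bends of a secondary path lying on the sewing paths. -/
def bendsOn (s : Bool) : Set (ℤ × ℤ) :=
  {p | (R.path (W k i s)).IsBend p ∧ ∃ j : Fin (k + 2), p ∈ (R.path (GkV.u i j)).toSet}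

theorem bendsOn_finite (s : Bool) : (bendsOn R i s).Finite := by
  apply Set.Finite.subset (List.finite_toSet (R.path (W k i s)).pts)
  rintro p ⟨⟨a, c, h, -⟩, -⟩
  exact h.subset (by simp)

theorem count_bends (hp : ∀ s, IsPure R (W k i s)) :
    ∃ s : Bool, (k + 2) / 2 ≤ (bendsOn R i s).ncard ∧ (k + 1) / 2 ≤ (bendsOn R i !s).ncard := by
  have hex : ∀ j : ℕ, ∃ (s : Bool) (p : ℤ × ℤ), ∀ h : j < k + 1,
      p ∈ (R.path (W k i s)).toSet ∧
      p ∈ (R.path (GkV.u i ⟨j, by omega⟩)).toSet ∧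
      p ∈ (R.path (GkV.u i ⟨j + 1, by omega⟩)).toSet := by
    intro j
    by_cases h : j < k + 1
    · obtain ⟨s, p, hh⟩ := exists_contact R i hp (j := ⟨j, by omega⟩) (j' := ⟨j + 1, by omega⟩) rfl
      exact ⟨s, p, fun _ => hh⟩
    · exact ⟨true, (0, 0), fun h' => absurd h' h⟩
  choose σ c hc using hex
  have alt : ∀ j, j + 1 < k + 1 → σ (j + 1) = !(σ j) := by
    intro j hj
    obtain ⟨a1, a2, a3⟩ := hc j (by omega)
    obtain ⟨b1, b2, b3⟩ := hc (j + 1) hj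
    by_contra hne
    have hs : σ (j + 1) = σ j := by
      cases h1 : σ (j + 1) <;> cases h2 : σ j <;> simp_all
    rw [hs] at b1
    have hcc := contact_unique R i hp a1 a3 b1 b2
    rw [← hcc] at b3
    exact not_three R i (hp _) (by simp) (by simp; omega) (by simp) a1 a2 a3 b3
  have inj : ∀ j j', j < j' → j' < k + 1 → σ j = σ j' → c j ≠ c j' := by
    intro j j' hlt hj' hs hcc
    obtain ⟨a1, a2, a3⟩ := hc j (by omega)
    obtain ⟨b1, b2, b3⟩ := hc j' hj'
    rw [← hcc] at b3
    exact not_three R i (hp _) (by simp) (by simp; omega) (by simp; omega) a1 a2 a3 b3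
  have inB : ∀ j, j < k + 1 → c j ∈ bendsOn R i (σ j) := by
    intro j hj
    obtain ⟨a1, a2, a3⟩ := hc j hj
    exact ⟨bend_at R i hp (by simp) a1 a2 a3, _, a2⟩
  have par : ∀ m, (2 * m < k + 1 → σ (2 * m) = σ 0) ∧ (2 * m + 1 < k + 1 → σ (2 * m + 1) = !(σ 0)) := by
    intro m
    induction m with
    | zero => exact ⟨fun _ => rfl, fun h => alt 0 h⟩
    | succ m ih =>
      have e : 2 * (m + 1) < k + 1 → σ (2 * (m + 1)) = σ 0 := by
        intro h
        have h1 := alt (2 * m + 1) h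
        rw [ih.2 (by omega)] at h1
        rw [Bool.not_not] at h1
        exact h1
      refine ⟨e, fun h => ?_⟩
      rw [alt _ h, e (by omega)]
  have cnt : ∀ (s : Bool) (n : ℕ) (g : ℕ → ℕ), StrictMono g →
      (∀ m < n, g m < k + 1 ∧ σ (g m) = s) → n ≤ (bendsOn R i s).ncard := by
    intro s n g hg h
    have hsub : (c ∘ g) '' (Finset.range n : Set ℕ) ⊆ bendsOn R i s := by
      rintro _ ⟨m, hm, rfl⟩
      obtain ⟨h1, h2⟩ := h m (by simpa using hm)
      rw [← h2]
      exact inB _ h1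
    have hinj : Set.InjOn (c ∘ g) (Finset.range n : Set ℕ) := by
      intro x hx y hy hxy
      obtain ⟨x1, x2⟩ := h x (by simpa using hx)
      obtain ⟨y1, y2⟩ := h y (by simpa using hy)
      rcases lt_trichotomy x y with hlt | heq | hlt
      · exact absurd hxy (inj _ _ (hg hlt) y1 (x2.trans y2.symm))
      · exact heq
      · exact absurd hxy.symm (inj _ _ (hg hlt) x1 (y2.trans x2.symm))
    have := Set.ncard_le_ncard hsub (bendsOn_finite R i s)
    rw [Set.InjOn.ncard_image hinj, Set.ncard_coe_finset, Finset.card_range] at this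
    exact this
  refine ⟨σ 0, cnt _ _ (fun m => 2 * m) (fun a b h => by simp only; omega) ?_,
    cnt _ _ (fun m => 2 * m + 1) (fun a b h => by simp only; omega) ?_⟩
  · intro m hm
    have : 2 * m < k + 1 := by omega
    exact ⟨this, (par m).1 this⟩
  · intro m hm
    have : 2 * m + 1 < k + 1 := by omega
    exact ⟨this, (par m).2 this⟩

end

end GkProof

/-- Claim 3 of the paper: if `P_{α_i}` and `P_{α_{i+1}}` are both pure, then one of them
has at least `⌊(k+1)/2⌋` bend points and the other at least `⌈(k+1)/2⌉` bend points that
moreover all belong to the `(i,i+1)`-sewing paths `P_{u^i_1}, …, P_{u^i_{k+2}}`. -/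
theorem bends_of_pure_secondary_paths (k : ℕ) (R : CPGRep (Gk k)) (i : Fin 19)
    (hpure₁ : IsPure R (GkV.α i.castSucc)) (hpure₂ : IsPure R (GkV.α i.succ)) :
    (({p : ℤ × ℤ | (R.path (GkV.α i.castSucc)).IsBend p ∧
          ∃ j : Fin (k + 2), p ∈ (R.path (GkV.u i j)).toSet}.ncard ≥ (k + 1) / 2 ∧
        {p : ℤ × ℤ | (R.path (GkV.α i.succ)).IsBend p ∧
          ∃ j : Fin (k + 2), p ∈ (R.path (GkV.u i j)).toSet}.ncard ≥ (k + 2) / 2) ∨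
      ({p : ℤ × ℤ | (R.path (GkV.α i.castSucc)).IsBend p ∧
          ∃ j : Fin (k + 2), p ∈ (R.path (GkV.u i j)).toSet}.ncard ≥ (k + 2) / 2 ∧
        {p : ℤ × ℤ | (R.path (GkV.α i.succ)).IsBend p ∧
          ∃ j : Fin (k + 2), p ∈ (R.path (GkV.u i j)).toSet}.ncard ≥ (k + 1) / 2)) := by
  have hp : ∀ s, IsPure R (GkProof.W k i s) := by
    intro s
    cases s
    · exact hpure₁
    · exact hpure₂
  obtain ⟨s, h1, h2⟩ := GkProof.count_bends R i hp
  cases s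
  · exact Or.inr ⟨h1, h2⟩
  · exact Or.inl ⟨h2, h1⟩
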